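/- arXiv:2501.01325 — 2 statements merged into one kernel-verified Lean document; each statement's English description precedes it below -/
import Mathlib

section
/- Let Q₁,…,Q_d ∈ M_m(ℂ) and T₁,…,T_d ∈ M_k(ℂ), and let 0 ≤ t be such that ‖Σ_{j=1}^d T_j ⊗ Q_j‖ ≤ t, where ⊗ is the Kronecker product and ‖·‖ the operator norm. Then for every n ≥ 1, ‖Σ_{|w|=n} T^w ⊗ (Q_{w₁} ⊗ Q_{w₂} ⊗ ⋯ ⊗ Q_{wₙ})‖ ≤ tⁿ, the sum being over all words w = w₁⋯wₙ in {1,…,d} and T^w = T_{w₁}⋯T_{wₙ}. -/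
open scoped Matrix Kronecker

/-- The operator norm of a square complex matrix, viewed as a linear operator on
Euclidean space (largest singular value). -/
noncomputable def opNorm {ι : Type*} [Fintype ι] [DecidableEq ι] (X : Matrix ι ι ℂ) : ℝ :=
  ‖Matrix.toEuclideanCLM (𝕜 := ℂ) X‖

/-- For a word `w = w₁⋯wₙ`, the ordered product `T_{w₁} T_{w₂} ⋯ T_{wₙ}`. -/
def wordProd {M : Type*} [Monoid M] {d n : ℕ} (T : Fin d → M) (w : Fin n → Fin d) : M :=
  (List.ofFn fun i => T (w i)).prod

/-- For a word `w = w₁⋯wₙ`, the iterated Kronecker product `Q_{w₁} ⊗ Q_{w₂} ⊗ ⋯ ⊗ Q_{wₙ}`,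
realized as a matrix indexed by functions `Fin n → Fin m`. -/
noncomputable def kronPow {d m n : ℕ} (Q : Fin d → Matrix (Fin m) (Fin m) ℂ)
    (w : Fin n → Fin d) : Matrix (Fin n → Fin m) (Fin n → Fin m) ℂ :=
  Matrix.of fun x y => ∏ i, Q (w i) (x i) (y i)

open scoped Matrix.Norms.L2Operator

/-- The star-algebra homomorphism `A ↦ A ⊗ 1`, with indices relabelled along `e`. -/
noncomputable def ampliation {ι ν κ : Type*} [Fintype ι] [DecidableEq ι] [Fintype ν]
    [DecidableEq ν] [Fintype κ] [DecidableEq κ] (e : κ ≃ ι × ν) :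
    Matrix ι ι ℂ →⋆ₙₐ[ℂ] Matrix κ κ ℂ where
  toFun A := (A ⊗ₖ (1 : Matrix ν ν ℂ)).submatrix e e
  map_smul' r A := by
    simp [Matrix.smul_kronecker, Matrix.submatrix_smul]
  map_zero' := by simp
  map_add' A B := by
    simp [Matrix.add_kronecker, Matrix.submatrix_add]
  map_mul' A B := by
    rw [Matrix.submatrix_mul_equiv, ← Matrix.mul_kronecker_mul, one_mul]
  map_star' A := by
    simp [Matrix.star_eq_conjTranspose, Matrix.conjTranspose_kronecker,
      Matrix.conjTranspose_submatrix]

theorem opNorm_ampliation_le {ι ν κ : Type*} [Fintype ι] [DecidableEq ι] [Fintype ν]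
    [DecidableEq ν] [Fintype κ] [DecidableEq κ] (e : κ ≃ ι × ν) (A : Matrix ι ι ℂ) :
    opNorm (ampliation e A) ≤ opNorm A :=
  NonUnitalStarAlgHom.norm_apply_le (ampliation e) A

theorem opNorm_mul_le {ι : Type*} [Fintype ι] [DecidableEq ι] (A B : Matrix ι ι ℂ) :
    opNorm (A * B) ≤ opNorm A * opNorm B :=
  Matrix.l2_opNorm_mul A B

theorem opNorm_one_le {ι : Type*} [Fintype ι] [DecidableEq ι] :
    opNorm (1 : Matrix ι ι ℂ) ≤ 1 := by
  rw [opNorm, map_one]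
  exact ContinuousLinearMap.norm_id_le

theorem opNorm_nonneg {ι : Type*} [Fintype ι] [DecidableEq ι] (A : Matrix ι ι ℂ) :
    0 ≤ opNorm A :=
  norm_nonneg _

theorem wordProd_cons {M : Type*} [Monoid M] {d n : ℕ} (T : Fin d → M) (j : Fin d)
    (v : Fin n → Fin d) :
    wordProd T (Fin.cons j v : Fin (n + 1) → Fin d) = T j * wordProd T v := by
  simp [wordProd, List.ofFn_succ]

/-- Splitting a tuple into its first entry and its tail. -/
def tupleSplit (m n : ℕ) : (Fin (n + 1) → Fin m) ≃ Fin m × (Fin n → Fin m) :=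
  (Fin.consEquiv fun _ => Fin m).symm

theorem kronPow_cons {d m n : ℕ} (Q : Fin d → Matrix (Fin m) (Fin m) ℂ) (j : Fin d)
    (v : Fin n → Fin d) :
    kronPow Q (Fin.cons j v : Fin (n + 1) → Fin d) =
      (Q j ⊗ₖ kronPow Q v).submatrix (tupleSplit m n) (tupleSplit m n) := by
  ext x y
  simp [kronPow, Fin.prod_univ_succ, tupleSplit, Fin.consEquiv, Fin.tail]

/-- Grouping the first tuple entry with the extra index. -/
def headSplit (k m n : ℕ) :
    Fin k × (Fin (n + 1) → Fin m) ≃ (Fin k × Fin m) × (Fin n → Fin m) :=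
  ((Equiv.refl _).prodCongr (tupleSplit m n)).trans (Equiv.prodAssoc _ _ _).symm

/-- Grouping the tail of the tuple with the extra index. -/
def tailSplit (k m n : ℕ) :
    Fin k × (Fin (n + 1) → Fin m) ≃ (Fin k × (Fin n → Fin m)) × Fin m :=
  ((Equiv.refl _).prodCongr ((tupleSplit m n).trans (Equiv.prodComm _ _))).trans
    (Equiv.prodAssoc _ _ _).symm

theorem ampliation_headSplit_kronecker {k m n : ℕ} (A : Matrix (Fin k) (Fin k) ℂ)
    (B : Matrix (Fin m) (Fin m) ℂ) :
    ampliation (headSplit k m n) (A ⊗ₖ B) =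
      A ⊗ₖ (B ⊗ₖ (1 : Matrix (Fin n → Fin m) (Fin n → Fin m) ℂ)).submatrix
        (tupleSplit m n) (tupleSplit m n) := by
  ext x y
  exact mul_assoc _ _ _

theorem ampliation_tailSplit_kronecker {k m n : ℕ} (A : Matrix (Fin k) (Fin k) ℂ)
    (B : Matrix (Fin n → Fin m) (Fin n → Fin m) ℂ) :
    ampliation (tailSplit k m n) (A ⊗ₖ B) =
      A ⊗ₖ ((1 : Matrix (Fin m) (Fin m) ℂ) ⊗ₖ B).submatrix
        (tupleSplit m n) (tupleSplit m n) := by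
  ext x y
  exact (mul_assoc _ _ _).trans (congrArg _ (mul_comm _ _))

theorem wordProd_kronecker_kronPow_cons {d m k n : ℕ} (Q : Fin d → Matrix (Fin m) (Fin m) ℂ)
    (T : Fin d → Matrix (Fin k) (Fin k) ℂ) (j : Fin d) (v : Fin n → Fin d) :
    wordProd T (Fin.cons j v : Fin (n + 1) → Fin d) ⊗ₖ
        kronPow Q (Fin.cons j v : Fin (n + 1) → Fin d) =
      ampliation (headSplit k m n) (T j ⊗ₖ Q j) *
        ampliation (tailSplit k m n) (wordProd T v ⊗ₖ kronPow Q v) := by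
  rw [ampliation_headSplit_kronecker, ampliation_tailSplit_kronecker,
    ← Matrix.mul_kronecker_mul, Matrix.submatrix_mul_equiv, ← Matrix.mul_kronecker_mul,
    one_mul, mul_one, wordProd_cons, kronPow_cons]

theorem sum_word_kronecker_succ {d m k : ℕ} (Q : Fin d → Matrix (Fin m) (Fin m) ℂ)
    (T : Fin d → Matrix (Fin k) (Fin k) ℂ) (n : ℕ) :
    ∑ w : Fin (n + 1) → Fin d, wordProd T w ⊗ₖ kronPow Q w =
      ampliation (headSplit k m n) (∑ j, T j ⊗ₖ Q j) *
        ampliation (tailSplit k m n) (∑ v : Fin n → Fin d, wordProd T v ⊗ₖ kronPow Q v) := by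
  rw [map_sum, map_sum, Finset.sum_mul_sum, ← Fintype.sum_prod_type',
    ← (Fin.consEquiv fun _ => Fin d).sum_comp]
  exact Finset.sum_congr rfl fun p _ => wordProd_kronecker_kronPow_cons Q T p.1 p.2

theorem sum_word_kronecker_zero {d m k : ℕ} (Q : Fin d → Matrix (Fin m) (Fin m) ℂ)
    (T : Fin d → Matrix (Fin k) (Fin k) ℂ) :
    ∑ w : Fin 0 → Fin d, wordProd T w ⊗ₖ kronPow Q w = 1 := by
  ext ⟨a, x⟩ ⟨b, y⟩
  simp [wordProd, kronPow, Matrix.one_apply, Subsingleton.elim x y]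

/-- If `‖Σ_j T_j ⊗ Q_j‖ ≤ t`, then for every `n ≥ 1`,
`‖Σ_{|w|=n} T^w ⊗ Q_{w₁} ⊗ ⋯ ⊗ Q_{wₙ}‖ ≤ tⁿ`. -/
theorem kron_word_sum_norm_le_pow (d m k : ℕ)
    (Q : Fin d → Matrix (Fin m) (Fin m) ℂ) (T : Fin d → Matrix (Fin k) (Fin k) ℂ)
    (t : ℝ) (ht : 0 ≤ t) (h : opNorm (∑ j, (T j) ⊗ₖ (Q j)) ≤ t) (n : ℕ) (hn : 1 ≤ n) :
    opNorm (∑ w : Fin n → Fin d, (wordProd T w) ⊗ₖ (kronPow Q w)) ≤ t ^ n := by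
  clear hn
  induction n with
  | zero =>
    rw [sum_word_kronecker_zero, pow_zero]
    exact opNorm_one_le
  | succ n ih =>
    rw [sum_word_kronecker_succ, pow_succ']
    exact (opNorm_mul_le _ _).trans <| mul_le_mul ((opNorm_ampliation_le _ _).trans h)
      ((opNorm_ampliation_le _ _).trans ih) (opNorm_nonneg _) ht
end

section
/- Let A₁ = [[1/2,0,0],[-1/2,0,0],[1/√2,0,0]], A₂ = [[0,-1/2,0],[0,1/2,0],[0,1/√2,0]] ∈ M₃(ℂ). Then for every n ≥ 1, max over all words w of length n in {1,2} of ‖A^w‖ equals 2^{1-n}, and consequently the Rota–Strang joint spectral radius ρ_{RS}(A) = lim_{n→∞} (max_{|w|=n} ‖A^w‖)^{1/n} equals 1/2. -/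
open Filter Topology
open scoped Matrix

/-- The matrix `A₁` of the descriptor realization of `(2zw - z - w)/(2 - z - w)`. -/
noncomputable def A₁ : Matrix (Fin 3) (Fin 3) ℂ :=
  !![1/2, 0, 0; -(1/2), 0, 0; 1/(Real.sqrt 2 : ℂ), 0, 0]

/-- The matrix `A₂` of the descriptor realization of `(2zw - z - w)/(2 - z - w)`. -/
noncomputable def A₂ : Matrix (Fin 3) (Fin 3) ℂ :=
  !![0, -(1/2), 0; 0, 1/2, 0; 0, 1/(Real.sqrt 2 : ℂ), 0]

/-- The operator norm of a rank-one matrix is the product of the norms of its factors. -/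
theorem opNorm_vecMulVec_star {ι : Type*} [Fintype ι] [DecidableEq ι]
    (x y : EuclideanSpace ℂ ι) :
    opNorm (Matrix.vecMulVec x.ofLp (star y.ofLp)) = ‖x‖ * ‖y‖ := by
  have h : Matrix.toEuclideanCLM (𝕜 := ℂ) (Matrix.vecMulVec x.ofLp (star y.ofLp)) =
      InnerProductSpace.rankOne ℂ x y := by
    ext z i
    simp [Matrix.vecMulVec_mulVec, PiLp.inner_apply, dotProduct, mul_comm]
  rw [opNorm, h, InnerProductSpace.norm_rankOne]

theorem opNorm_smul {ι : Type*} [Fintype ι] [DecidableEq ι] (c : ℂ) (X : Matrix ι ι ℂ) :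
    opNorm (c • X) = ‖c‖ * opNorm X := by
  rw [opNorm, map_smul, norm_smul, opNorm]

theorem wordProd_succ {M : Type*} [Monoid M] {d n : ℕ} (T : Fin d → M) (w : Fin (n + 1) → Fin d) :
    wordProd T w = T (w 0) * wordProd T (Fin.tail w) := by
  simp [wordProd, List.ofFn_succ, Fin.tail]

/-- A product of rank-one matrices `u i • (v i)ᵀ` whose pairings `v i ⬝ᵥ u j` all have modulus `r`
is a multiple of a rank-one matrix `u i • (v j)ᵀ`. -/
theorem exists_wordProd_vecMulVec {ι : Type*} [Fintype ι] [DecidableEq ι] {d : ℕ}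
    {u v : Fin d → ι → ℂ} {r : ℝ} (h : ∀ i j, ‖v i ⬝ᵥ u j‖ = r) (n : ℕ)
    (w : Fin (n + 1) → Fin d) :
    ∃ (c : ℂ) (j : Fin d), ‖c‖ = r ^ n ∧
      wordProd (fun i => Matrix.vecMulVec (u i) (v i)) w =
        c • Matrix.vecMulVec (u (w 0)) (v j) := by
  induction n with
  | zero => exact ⟨1, w 0, by simp, by simp [wordProd]⟩
  | succ n ih =>
    obtain ⟨c, j, hc, hw⟩ := ih (Fin.tail w)
    refine ⟨c * (v (w 0) ⬝ᵥ u (Fin.tail w 0)), j, ?_, ?_⟩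
    · rw [norm_mul, hc, h, pow_succ]
    · rw [wordProd_succ, hw, Matrix.mul_smul, Matrix.vecMulVec_mul_vecMulVec,
        Matrix.vecMulVec_smul, smul_smul]

/-- The nonzero columns of `A₁` and `A₂`. -/
noncomputable def columnVec : Fin 2 → EuclideanSpace ℂ (Fin 3) :=
  ![!₂[1/2, -(1/2), 1/(Real.sqrt 2 : ℂ)], !₂[-(1/2), 1/2, 1/(Real.sqrt 2 : ℂ)]]

/-- The standard basis vectors picking out the nonzero columns of `A₁` and `A₂`. -/
noncomputable def rowVec : Fin 2 → EuclideanSpace ℂ (Fin 3) :=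
  ![!₂[1, 0, 0], !₂[0, 1, 0]]

theorem norm_columnVec (i : Fin 2) : ‖columnVec i‖ = 1 := by
  rw [EuclideanSpace.norm_eq, Real.sqrt_eq_one]
  fin_cases i <;> simp [columnVec, Fin.sum_univ_three] <;> norm_num

theorem norm_rowVec (i : Fin 2) : ‖rowVec i‖ = 1 := by
  rw [EuclideanSpace.norm_eq, Real.sqrt_eq_one]
  fin_cases i <;> simp [rowVec, Fin.sum_univ_three]

theorem norm_rowVec_dotProduct_columnVec (i j : Fin 2) :
    ‖star (rowVec i).ofLp ⬝ᵥ (columnVec j).ofLp‖ = 1 / 2 := by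
  fin_cases i <;> fin_cases j <;>
    simp [rowVec, columnVec, dotProduct, Fin.sum_univ_three]

theorem cons_A₁_A₂_eq :
    ![A₁, A₂] = fun i => Matrix.vecMulVec (columnVec i).ofLp (star (rowVec i).ofLp) := by
  ext k i j
  fin_cases k <;> fin_cases i <;> fin_cases j <;>
    simp [A₁, A₂, Matrix.vecMulVec_apply, columnVec, rowVec]

theorem opNorm_wordProd_A (n : ℕ) (w : Fin (n + 1) → Fin 2) :
    opNorm (wordProd ![A₁, A₂] w) = (1 / 2) ^ n := by
  obtain ⟨c, j, hc, hw⟩ := exists_wordProd_vecMulVec (u := fun i => (columnVec i).ofLp)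
    (v := fun i => star (rowVec i).ofLp) norm_rowVec_dotProduct_columnVec n w
  rw [cons_A₁_A₂_eq, hw, opNorm_smul, opNorm_vecMulVec_star, norm_columnVec, norm_rowVec, hc]
  simp

theorem sup'_opNorm_wordProd_A (n : ℕ) (hn : 1 ≤ n) :
    (Finset.univ.sup' Finset.univ_nonempty
      fun w : Fin n → Fin 2 => opNorm (wordProd ![A₁, A₂] w)) = (2 : ℝ) ^ ((1 : ℤ) - n) := by
  obtain ⟨n, rfl⟩ := Nat.exists_eq_add_of_le' hn
  refine Finset.sup'_eq_of_forall _ _ fun w _ => ?_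
  rw [opNorm_wordProd_A, show (1 : ℤ) - (n + 1 : ℕ) = -(n : ℤ) by push_cast; ring]
  simp

theorem tendsto_two_zpow_one_sub_rpow_one_div :
    Tendsto (fun n : ℕ => ((2 : ℝ) ^ ((1 : ℤ) - n)) ^ ((1 : ℝ) / n)) atTop (𝓝 (1 / 2)) := by
  have h : Tendsto (fun n : ℕ => (2 : ℝ) ^ ((1 : ℝ) / n - 1)) atTop (𝓝 (2 ^ ((0 : ℝ) - 1))) :=
    (Real.continuous_const_rpow two_ne_zero).continuousAt.tendsto.comp
      ((tendsto_one_div_atTop_nhds_zero_nat (𝕜 := ℝ)).sub_const 1)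
  rw [zero_sub, Real.rpow_neg_one, ← one_div] at h
  refine h.congr' ?_
  filter_upwards [eventually_ne_atTop 0] with n hn
  rw [← Real.rpow_intCast, ← Real.rpow_mul zero_le_two]
  congr 1
  push_cast
  field_simp

/-- For every `n ≥ 1`, `max_{|w|=n} ‖A^w‖ = 2^{1-n}`, and consequently the Rota–Strang
joint spectral radius `ρ_{RS}(A) = lim_n (max_{|w|=n} ‖A^w‖)^{1/n}` equals `1/2`. -/
theorem rota_strang_radius_famous_example :
    (∀ n : ℕ, 1 ≤ n →
      (Finset.univ.sup' Finset.univ_nonempty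
          fun w : Fin n → Fin 2 => opNorm (wordProd ![A₁, A₂] w))
        = (2 : ℝ) ^ ((1 : ℤ) - n)) ∧
    Tendsto
      (fun n : ℕ =>
        (Finset.univ.sup' Finset.univ_nonempty
            fun w : Fin n → Fin 2 => opNorm (wordProd ![A₁, A₂] w)) ^ ((1 : ℝ) / n))
      atTop (𝓝 (1/2)) := by
  refine ⟨sup'_opNorm_wordProd_A, tendsto_two_zpow_one_sub_rpow_one_div.congr' ?_⟩
  filter_upwards [eventually_ge_atTop 1] with n hn
  rw [sup'_opNorm_wordProd_A n hn]
end
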